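/- arXiv:1212.4175 — 2 statements merged into one kernel-verified Lean document; each statement's English description precedes it below -/
import Mathlib

section
/- Let x be a vertex of a finite simple graph G that has a bipartition. Then the number of maximal stable sets of G that contain every neighbour of x is at most the number of maximal stable sets of G that contain x, i.e. |MSS_{N(x)}(G)| ≤ |MSS_x(G)|. -/
/-- A set of vertices is stable (independent): no two of its vertices are adjacent. -/
def IsStable {V : Type*} (G : SimpleGraph V) (S : Set V) : Prop :=
  ∀ ⦃u⦄, u ∈ S → ∀ ⦃v⦄, v ∈ S → ¬G.Adj u v

/-- A maximal stable set: stable, and every vertex outside has a neighbour inside. -/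
def IsMaxStable {V : Type*} (G : SimpleGraph V) (S : Set V) : Prop :=
  IsStable G S ∧ ∀ v ∉ S, ∃ u ∈ S, G.Adj v u

/-- The set of all maximal stable sets of `G`. -/
def MSS {V : Type*} (G : SimpleGraph V) : Set (Set V) := {S | IsMaxStable G S}

/-- The number of maximal stable sets of `G` containing all vertices of `X`. -/
noncomputable def mssOn {V : Type*} (G : SimpleGraph V) (X : Set V) : ℕ :=
  {S | S ∈ MSS G ∧ X ⊆ S}.ncard

/-- A vertex is rare if it lies in at most half of the maximal stable sets. -/
def Rare {V : Type*} (G : SimpleGraph V) (v : V) : Prop :=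
  2 * mssOn G {v} ≤ (MSS G).ncard

/-- The neighbourhood of a set of vertices: all vertices with a neighbour in `A`. -/
def NSet {V : Type*} (G : SimpleGraph V) (A : Set V) : Set V := {v | ∃ u ∈ A, G.Adj v u}

/-- A bipartition of `G`: a partition of the vertex set into two stable sets. -/
def IsBipartition {V : Type*} (G : SimpleGraph V) (U W : Set V) : Prop :=
  U ∪ W = Set.univ ∧ Disjoint U W ∧ IsStable G U ∧ IsStable G W

theorem IsBipartition.symm {V : Type*} {G : SimpleGraph V} {U W : Set V}
    (h : IsBipartition G U W) : IsBipartition G W U :=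
  ⟨by rw [Set.union_comm]; exact h.1, h.2.1.symm, h.2.2.2, h.2.2.1⟩

/-- The stable set generated by the part of `S` in `W` outside the neighbourhood of `x`:
that part, together with all vertices of `U` that have no neighbour in it. -/
def exchange {V : Type*} (G : SimpleGraph V) (U W : Set V) (x : V) (S : Set V) : Set V :=
  ((S ∩ W) \ G.neighborSet x) ∪ (U \ NSet G ((S ∩ W) \ G.neighborSet x))

theorem mem_exchange {V : Type*} {G : SimpleGraph V} {U W : Set V} {x v : V} {S : Set V} :
    v ∈ exchange G U W x S ↔ ((v ∈ S ∧ v ∈ W) ∧ ¬G.Adj x v) ∨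
      (v ∈ U ∧ ∀ u, (u ∈ S ∧ u ∈ W) ∧ ¬G.Adj x u → ¬G.Adj v u) := by
  simp [exchange, NSet]

theorem mem_exchange_self {V : Type*} {G : SimpleGraph V} {U W : Set V} {x : V} (hx : x ∈ U)
    (S : Set V) : x ∈ exchange G U W x S :=
  mem_exchange.2 (Or.inr ⟨hx, fun _ hu => hu.2⟩)

theorem isMaxStable_exchange {V : Type*} {G : SimpleGraph V} {U W : Set V}
    (h : IsBipartition G U W) {x : V} (hx : x ∈ U) {S : Set V} (hS : IsMaxStable G S) :
    IsMaxStable G (exchange G U W x S) := by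
  obtain ⟨hUW, -, hU, hW⟩ := h
  have cover (v : V) : v ∈ U ∨ v ∈ W := by
    rw [← Set.mem_union, hUW]; trivial
  refine ⟨fun u hu v hv huv => ?_, fun v hv => ?_⟩
  · rw [mem_exchange] at hu hv
    rcases hu with hu | hu <;> rcases hv with hv | hv
    · exact hW hu.1.2 hv.1.2 huv
    · exact hv.2 u hu huv.symm
    · exact hu.2 v hv huv
    · exact hU hu.1 hv.1 huv
  · rcases cover v with hvU | hvW
    · rw [mem_exchange] at hv
      push Not at hv
      obtain ⟨u, hu, huv⟩ := hv.2 hvU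
      exact ⟨u, mem_exchange.2 (Or.inl hu), huv⟩
    · by_cases hxv : G.Adj x v
      · exact ⟨x, mem_exchange_self hx S, hxv.symm⟩
      · have hvS : v ∉ S := fun hvS => hv (mem_exchange.2 (Or.inl ⟨⟨hvS, hvW⟩, hxv⟩))
        obtain ⟨u, huS, huv⟩ := hS.2 v hvS
        have huU : u ∈ U := (cover u).resolve_right fun huW => hW hvW huW huv
        exact ⟨u, mem_exchange.2 (Or.inr ⟨huU, fun w hw => hS.1 huS hw.1.1⟩), huv⟩

/-- A maximal stable set is determined by its part in one side of a bipartition. -/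
theorem IsMaxStable.subset_of_inter_subset {V : Type*} {G : SimpleGraph V} {U W : Set V}
    (h : IsBipartition G U W) {S T : Set V} (hS : IsMaxStable G S) (hT : IsMaxStable G T)
    (hST : S ∩ W = T ∩ W) : S ⊆ T := by
  intro v hvS
  by_contra hvT
  obtain ⟨hUW, -, hU, -⟩ := h
  have cover (v : V) : v ∈ U ∨ v ∈ W := by
    rw [← Set.mem_union, hUW]; trivial
  obtain ⟨u, huT, hvu⟩ := hT.2 v hvT
  rcases cover v with hvU | hvW
  · have huW : u ∈ W := (cover u).resolve_left fun huU => hU hvU huU hvu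
    exact hS.1 hvS (hST.symm.subset ⟨huT, huW⟩).1 hvu
  · exact hvT (hST.subset ⟨hvS, hvW⟩).1

theorem exchange_inter {V : Type*} {G : SimpleGraph V} {U W : Set V}
    (h : IsBipartition G U W) (x : V) (S : Set V) :
    exchange G U W x S ∩ W = (S ∩ W) \ G.neighborSet x := by
  ext v
  have hUW : v ∈ U → v ∉ W := fun hvU => Set.disjoint_left.1 h.2.1 hvU
  simp only [Set.mem_inter_iff, mem_exchange, Set.mem_sdiff, SimpleGraph.mem_neighborSet]
  tauto

theorem mssOn_neighborSet_le_of_mem {V : Type*} [Finite V] {G : SimpleGraph V} {U W : Set V}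
    (h : IsBipartition G U W) {x : V} (hx : x ∈ U) :
    mssOn G (G.neighborSet x) ≤ mssOn G {x} := by
  refine Set.ncard_le_ncard_of_injOn (exchange G U W x) ?_ ?_ (Set.toFinite _)
  · rintro S ⟨hS, -⟩
    exact ⟨isMaxStable_exchange h hx hS, Set.singleton_subset_iff.2 (mem_exchange_self hx S)⟩
  · rintro S ⟨hS, hxS⟩ T ⟨hT, hxT⟩ hST
    have hdiff : (S ∩ W) \ G.neighborSet x = (T ∩ W) \ G.neighborSet x := by
      rw [← exchange_inter h, ← exchange_inter h, hST]
    have hinter : S ∩ W = T ∩ W := by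
      ext v
      have hv := Set.ext_iff.1 hdiff v
      have hvS := @hxS v
      have hvT := @hxT v
      simp only [Set.mem_sdiff, Set.mem_inter_iff] at hv ⊢
      tauto
    exact (hS.subset_of_inter_subset h hT hinter).antisymm
      (hT.subset_of_inter_subset h hS hinter.symm)

/-- In a graph admitting a bipartition, the number of maximal stable sets containing all
neighbours of `x` is at most the number of maximal stable sets containing `x`. -/
theorem mssOn_neighborSet_le {V : Type} [Fintype V] (G : SimpleGraph V)
    (hb : ∃ U W, IsBipartition G U W) (x : V) :
    mssOn G (G.neighborSet x) ≤ mssOn G {x} := by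
  obtain ⟨U, W, h⟩ := hb
  have hx : x ∈ U ∪ W := by rw [h.1]; trivial
  rcases hx with hx | hx
  · exact mssOn_neighborSet_le_of_mem h hx
  · exact mssOn_neighborSet_le_of_mem h.symm hx
end

section
/- Let G be a finite twin-free bipartite graph with bipartition (U, W) in which U is nonempty and every vertex of U has degree exactly 2. Then U contains a rare vertex. -/
open Finset Classical in
/-- The vertex sets inducing a subgraph of `H` without isolated vertices. -/
noncomputable def isolatedFree {V : Type*} [Fintype V] (H : SimpleGraph V) :
    Finset (Finset V) :=
  {C | ∀ v ∈ C, ∃ w ∈ C, H.Adj v w}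

section IsolatedFree

open Finset Classical

variable {V : Type*} [Fintype V] {H : SimpleGraph V}

lemma mem_isolatedFree {C : Finset V} :
    C ∈ isolatedFree H ↔ ∀ v ∈ C, ∃ w ∈ C, H.Adj v w := by
  simp [isolatedFree]

/-- Avoiding one more vertex `r` that has a neighbour `s` outside the avoided set shrinks the
family by a factor of at least `3 / 2`. -/
lemma three_mul_card_disjoint_insert_le {A : Finset V} {r s : V} (hr : r ∉ A) (hs : s ∉ A)
    (hrs : H.Adj r s) :
    3 * #{D ∈ isolatedFree H | Disjoint D (insert r A)} ≤
      2 * #{D ∈ isolatedFree H | Disjoint D A} := by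
  set P : Finset (Finset V) := {D ∈ isolatedFree H | Disjoint D (insert r A)} with hP
  set Q : Finset (Finset V) := {D ∈ isolatedFree H | Disjoint D A ∧ r ∈ D} with hQ
  have hsplit : #P + #Q = #{D ∈ isolatedFree H | Disjoint D A} := by
    rw [← card_filter_add_card_filter_not (s := {D ∈ isolatedFree H | Disjoint D A})
      (fun D => r ∉ D), filter_filter, filter_filter]
    congr 2
    · ext D; simp [hP, disjoint_insert_right, and_comm]
    · ext D; simp [hQ]
  have hle : #P ≤ 2 * #Q := by
    refine card_le_mul_card_image_of_maps_to (f := fun D => insert r (insert s D))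
      (fun D hD => ?_) 2 (fun E _ => ?_)
    · simp only [hP, hQ, mem_filter, mem_isolatedFree, disjoint_insert_right] at hD ⊢
      obtain ⟨hD, -, hDA⟩ := hD
      refine ⟨fun v hv => ?_, by simp [disjoint_insert_left, hr, hs, hDA], by simp⟩
      simp only [mem_insert] at hv
      rcases hv with rfl | rfl | hv
      · exact ⟨s, by simp, hrs⟩
      · exact ⟨r, by simp, hrs.symm⟩
      · obtain ⟨w, hw, hvw⟩ := hD v hv
        exact ⟨w, by simp [hw], hvw⟩
    · refine (card_le_card (t := {E.erase r, (E.erase r).erase s}) fun D hD => ?_).trans card_le_two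
      simp only [hP, mem_filter, disjoint_insert_right] at hD
      obtain ⟨⟨-, hrD, -⟩, rfl⟩ := hD
      have hne : r ≠ s := hrs.ne
      have : (insert r (insert s D)).erase r = insert s D :=
        erase_insert (by simp [hne, hrD])
      rw [this]
      by_cases hsD : s ∈ D
      · simp [insert_eq_of_mem hsD]
      · simp [erase_insert hsD]
  omega

lemma three_pow_mul_card_disjoint_le {z : V} (A : Finset V) (hz : z ∉ A)
    (hA : ∀ r ∈ A, #A + 1 ≤ #{s | H.Adj r s}) :
    3 ^ #A * #{D ∈ isolatedFree H | Disjoint D (insert z A)} ≤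
      2 ^ #A * #{D ∈ isolatedFree H | z ∉ D} := by
  induction A using Finset.induction_on with
  | empty => simp
  | insert r A hr ih =>
    rw [card_insert_of_notMem hr] at hA ⊢
    have hz' : z ≠ r ∧ z ∉ A := by simpa using hz
    have ih' := ih hz'.2 fun t ht => by have := hA t (by simp [ht]); omega
    obtain ⟨s, hs, hsA⟩ : ∃ s ∈ ({s | H.Adj r s} : Finset V), s ∉ insert z A := by
      refine exists_mem_notMem_of_card_lt_card ?_
      have := hA r (by simp)
      have := card_insert_le z A
      omega
    have hstep := three_mul_card_disjoint_insert_le (A := insert z A) (r := r) (s := s)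
      (by simp [hz'.1.symm, hr]) hsA (by simpa using hs)
    rw [insert_comm] at hstep
    calc _ = 3 ^ #A * (3 * #{D ∈ isolatedFree H | Disjoint D (insert z (insert r A))}) := by ring
      _ ≤ 3 ^ #A * (2 * #{D ∈ isolatedFree H | Disjoint D (insert z A)}) := by gcongr
      _ = 2 * (3 ^ #A * #{D ∈ isolatedFree H | Disjoint D (insert z A)}) := by ring
      _ ≤ 2 * (2 ^ #A * #{D ∈ isolatedFree H | z ∉ D}) := by gcongr
      _ = _ := by ring

/-- `z` is pendant at `x` in `C`: its only neighbour in `C` is `x`. -/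
def IsPendant (H : SimpleGraph V) (x : V) (C : Finset V) (z : V) : Prop :=
  z ∈ C ∧ H.Adj x z ∧ ∀ w ∈ C, H.Adj z w → w = x

/-- The members of `isolatedFree H` avoiding `z` and all its neighbours other than `x`. -/
noncomputable def avoiding (H : SimpleGraph V) (x z : V) : Finset (Finset V) :=
  {D ∈ isolatedFree H | z ∉ D ∧ ∀ w ∈ D, H.Adj z w → w = x}

lemma three_pow_mul_card_avoiding_le {x z : V} {k : ℕ} (hxz : H.Adj x z)
    (hdeg : ∀ v w, H.Adj v w → k + 1 ≤ #{s | H.Adj v s}) :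
    3 ^ k * #(avoiding H x z) ≤ 2 ^ k * #{D ∈ isolatedFree H | z ∉ D} := by
  have hcard : k ≤ #(({s | H.Adj z s} : Finset V).erase x) := by
    rw [card_erase_of_mem (by simpa using hxz.symm)]
    have := hdeg z x hxz.symm
    omega
  obtain ⟨A, hA, rfl⟩ := exists_subset_card_eq hcard
  have hadj : ∀ r ∈ A, r ≠ x ∧ H.Adj z r := fun r hr => by simpa using hA hr
  refine le_trans ?_ (three_pow_mul_card_disjoint_le (z := z) A
    (fun h => H.loopless.irrefl z (hadj z h).2) fun r hr => hdeg r z (hadj r hr).2.symm)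
  gcongr
  intro D hD
  simp only [avoiding, mem_filter, disjoint_insert_right] at hD ⊢
  refine ⟨hD.1, hD.2.1, disjoint_left.2 fun r hrD hrA => ?_⟩
  exact (hadj r hrA).1 (hD.2.2 r hrD (hadj r hrA).2)

lemma erase_mem_avoiding {x y z : V} {C : Finset V} (hC : C ∈ isolatedFree H)
    (hyC : y ∈ C) (hxy : H.Adj x y) (hyz : y ≠ z) (hz : IsPendant H x C z) :
    C.erase z ∈ avoiding H x z := by
  rw [mem_isolatedFree] at hC
  simp only [avoiding, mem_filter, mem_isolatedFree, mem_erase]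
  refine ⟨?_, by simp, fun w hw => hz.2.2 w hw.2⟩
  rintro v ⟨hvz, hv⟩
  obtain ⟨w, hw, hvw⟩ := hC v hv
  by_cases hwz : w = z
  · obtain rfl := hz.2.2 v hv (hwz ▸ hvw.symm)
    exact ⟨y, ⟨hyz, hyC⟩, hxy⟩
  · exact ⟨w, ⟨hwz, hw⟩, hvw⟩

lemma erase_erase_mem_avoiding {x z : V} {C : Finset V} (hC : C ∈ isolatedFree H)
    (hz : IsPendant H x C z) (huniq : ∀ w, IsPendant H x C w → w = z) :
    (C.erase z).erase x ∈ avoiding H x z := by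
  rw [mem_isolatedFree] at hC
  simp only [avoiding, mem_filter, mem_isolatedFree, mem_erase]
  refine ⟨?_, by simp, fun w hw => hz.2.2 w hw.2.2⟩
  rintro v ⟨hvx, hvz, hv⟩
  by_contra! hcon
  have hall : ∀ w ∈ C, H.Adj v w → w = x := by
    intro w hw hvw
    by_contra hwx
    refine hcon w ⟨hwx, fun hwz => ?_, hw⟩ hvw
    exact hvx (hz.2.2 v hv (hwz ▸ hvw.symm))
  obtain ⟨w, hw, hvw⟩ := hC v hv
  exact hvz (huniq v ⟨hv, (hall w hw hvw ▸ hvw).symm, hall⟩)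

lemma card_pendant_add_card_unique_pendant_le {x y z : V} (hxy : H.Adj x y) (hyz : y ≠ z) :
    #{C ∈ isolatedFree H | (x ∈ C ∧ y ∈ C) ∧ IsPendant H x C z} +
      #{C ∈ isolatedFree H | (x ∈ C ∧ y ∈ C) ∧ IsPendant H x C z ∧
        ∀ w, IsPendant H x C w → w = z} ≤ #(avoiding H x z) := by
  rw [← card_filter_add_card_filter_not (s := avoiding H x z) (fun D => x ∈ D)]
  refine add_le_add ?_ ?_
  · refine card_le_card_of_injOn (fun C => C.erase z) (fun C hC => ?_) ?_
    · simp only [mem_coe, mem_filter] at hC ⊢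
      obtain ⟨hC, ⟨hx, hy⟩, hz⟩ := hC
      exact ⟨erase_mem_avoiding hC hy hxy hyz hz, mem_erase.2 ⟨hz.2.1.ne, hx⟩⟩
    · intro C hC D hD h
      simp only [mem_coe, mem_filter] at hC hD
      rw [← insert_erase hC.2.2.1, ← insert_erase hD.2.2.1]
      exact congrArg (insert z) h
  · refine card_le_card_of_injOn (fun C => (C.erase z).erase x) (fun C hC => ?_) ?_
    · simp only [mem_coe, mem_filter] at hC ⊢
      exact ⟨erase_erase_mem_avoiding hC.1 hC.2.2.1 hC.2.2.2, by simp⟩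
    · intro C hC D hD h
      simp only [mem_coe, mem_filter] at hC hD
      have hx {E : Finset V} (hE : x ∈ E) (hz : IsPendant H x E z) : x ∈ E.erase z :=
        mem_erase.2 ⟨hz.2.1.ne, hE⟩
      rw [← insert_erase hC.2.2.1.1, ← insert_erase hD.2.2.1.1,
        ← insert_erase (hx hC.2.1.1 hC.2.2.1), ← insert_erase (hx hD.2.1.1 hD.2.2.1)]
      exact congrArg (fun E => insert z (insert x E)) h

lemma card_pendant_self_le {x y : V} :
    #{C ∈ isolatedFree H | (x ∈ C ∧ y ∈ C) ∧ IsPendant H x C y} ≤ #(avoiding H x y) := by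
  have hmem {C : Finset V} (hC : C ∈ isolatedFree H) (hy : IsPendant H x C y)
      (h : ¬∃ w ∈ C, H.Adj x w ∧ w ≠ y) : (C.erase y).erase x ∈ avoiding H x y :=
    erase_erase_mem_avoiding hC hy fun w hw => by
      by_contra hwy
      exact h ⟨w, hw.1, hw.2.1, hwy⟩
  refine card_le_card_of_injOn
    (fun C => if ∃ w ∈ C, H.Adj x w ∧ w ≠ y then C.erase y else (C.erase y).erase x)
    (fun C hC => ?_) ?_
  · simp only [mem_coe, mem_filter] at hC ⊢
    obtain ⟨hC, ⟨hx, hy⟩, hp⟩ := hC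
    split_ifs with h
    · obtain ⟨w, hw, hxw, hwy⟩ := h
      exact erase_mem_avoiding hC hw hxw hwy hp
    · exact hmem hC hp h
  · intro C hC D hD h
    simp only [mem_coe, mem_filter] at hC hD
    obtain ⟨-, ⟨hxC, hyC⟩, hpC⟩ := hC
    obtain ⟨-, ⟨hxD, hyD⟩, hpD⟩ := hD
    have hne : x ≠ y := hpC.2.1.ne
    ext v
    have hv := Finset.ext_iff.1 h v
    by_cases hvx : v = x
    · simp [hvx, hxC, hxD]
    by_cases hvy : v = y
    · simp [hvy, hyC, hyD]
    dsimp only at hv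
    split_ifs at hv <;> simpa [hvx, hvy] using hv

lemma card_exists_pendant_le {x y : V} {k : ℕ} (hxy : H.Adj x y)
    (hk : #{s | H.Adj x s} = k + 1)
    (hdeg : ∀ v w, H.Adj v w → k + 1 ≤ #{s | H.Adj v s})
    (hmax : ∀ z, H.Adj x z → #{D ∈ isolatedFree H | z ∉ D} ≤ #{D ∈ isolatedFree H | y ∉ D}) :
    #{C ∈ isolatedFree H | (x ∈ C ∧ y ∈ C) ∧ ∃ z, IsPendant H x C z} ≤
      #{D ∈ isolatedFree H | y ∉ D} := by
  set N : Finset V := {s | H.Adj x s} with hN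
  set M := #{D ∈ isolatedFree H | y ∉ D}
  set a : V → ℕ := fun z => #{C ∈ isolatedFree H | (x ∈ C ∧ y ∈ C) ∧ IsPendant H x C z} with ha
  set b : V → ℕ := fun z => #{C ∈ isolatedFree H | (x ∈ C ∧ y ∈ C) ∧ IsPendant H x C z ∧
        ∀ w, IsPendant H x C w → w = z} with hb
  have hyN : y ∈ N := by simpa [hN] using hxy
  have hav : ∀ z ∈ N, 3 ^ k * #(avoiding H x z) ≤ 2 ^ k * M := fun z hz => by
    have hxz : H.Adj x z := by simpa [hN] using hz
    exact (three_pow_mul_card_avoiding_le hxz hdeg).trans (Nat.mul_le_mul_left _ (hmax z hxz))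
  have hcount : 2 * #{C ∈ isolatedFree H | (x ∈ C ∧ y ∈ C) ∧ ∃ z, IsPendant H x C z} ≤
      ∑ z ∈ N, (a z + b z) := by
    simp only [ha, hb, card_filter, ← sum_add_distrib, mul_sum]
    rw [sum_comm]
    refine sum_le_sum fun C _ => ?_
    split_ifs with h
    · obtain ⟨hC, z, hz⟩ := h
      have hzN : z ∈ N := by simpa [hN] using hz.2.1
      by_cases huniq : ∀ w, IsPendant H x C w → w = z
      · refine le_trans ?_ (single_le_sum (fun _ _ => Nat.zero_le _) hzN)
        simp only [if_pos (And.intro hC hz), if_pos (And.intro hC (And.intro hz huniq))]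
        omega
      · push Not at huniq
        obtain ⟨w, hw, hwz⟩ := huniq
        have hwN : w ∈ N := by simpa [hN] using hw.2.1
        refine le_trans ?_ (add_le_sum (fun _ _ => Nat.zero_le _) hwN hzN hwz)
        simp only [if_pos (And.intro hC hz), if_pos (And.intro hC hw)]
        omega
    · simp
  have hself : a y + b y ≤ 2 * #(avoiding H x y) := by
    have h1 : a y ≤ #(avoiding H x y) := card_pendant_self_le
    have h2 : b y ≤ a y := card_le_card fun C hC => by
      simp only [mem_filter] at hC ⊢
      exact ⟨hC.1, hC.2.1, hC.2.2.1⟩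
    omega
  have hsum : 3 ^ k * ∑ z ∈ N, (a z + b z) ≤ (k + 2) * (2 ^ k * M) := by
    rw [← add_sum_erase N _ hyN, mul_add]
    have h1 : 3 ^ k * (a y + b y) ≤ 2 * (2 ^ k * M) := by
      have := hav y hyN
      calc _ ≤ 3 ^ k * (2 * #(avoiding H x y)) := Nat.mul_le_mul_left _ hself
        _ = 2 * (3 ^ k * #(avoiding H x y)) := by ring
        _ ≤ _ := by omega
    have h2 : 3 ^ k * ∑ z ∈ N.erase y, (a z + b z) ≤ k * (2 ^ k * M) := by
      rw [mul_sum]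
      refine (sum_le_card_nsmul _ _ (2 ^ k * M) fun z hz => ?_).trans ?_
      · refine le_trans (Nat.mul_le_mul_left _ ?_) (hav z (mem_of_mem_erase hz))
        exact card_pendant_add_card_unique_pendant_le hxy (ne_of_mem_erase hz).symm
      · rw [card_erase_of_mem hyN, hk]
        simp
    linarith
  have hpow : (k + 2) * 2 ^ k ≤ 2 * 3 ^ k := by
    clear * -
    induction k with
    | zero => simp
    | succ k ih =>
      have : 2 ^ k * (k + 3) * 2 ≤ 2 ^ k * (3 * (k + 2)) := by
        rw [mul_assoc]; exact Nat.mul_le_mul_left _ (by omega)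
      rw [pow_succ, pow_succ]
      linarith
  have h3 : 0 < 2 * 3 ^ k := by positivity
  refine Nat.le_of_mul_le_mul_left ?_ h3
  calc _ = 3 ^ k * (2 * #{C ∈ isolatedFree H | (x ∈ C ∧ y ∈ C) ∧ ∃ z, IsPendant H x C z}) := by
        ring
    _ ≤ 3 ^ k * ∑ z ∈ N, (a z + b z) := Nat.mul_le_mul_left _ hcount
    _ ≤ (k + 2) * 2 ^ k * M := by rw [mul_assoc]; exact hsum
    _ ≤ 2 * 3 ^ k * M := Nat.mul_le_mul_right _ hpow

/-- Some edge is contained in at most half of the vertex sets that induce a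
subgraph without isolated vertices. -/
theorem exists_adj_two_mul_card_le (H : SimpleGraph V) (hH : ∃ x y, H.Adj x y) :
    ∃ x y, H.Adj x y ∧ 2 * #{C ∈ isolatedFree H | x ∈ C ∧ y ∈ C} ≤ #(isolatedFree H) := by
  obtain ⟨x₀, y₀, h₀⟩ := hH
  obtain ⟨x, hx, hxmin⟩ := exists_min_image ({v | ∃ w, H.Adj v w} : Finset V)
    (fun v => #{s | H.Adj v s}) ⟨x₀, by simpa using ⟨y₀, h₀⟩⟩
  obtain ⟨y₁, hy₁⟩ : ∃ w, H.Adj x w := by simpa using hx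
  obtain ⟨y, hy, hymax⟩ := exists_max_image ({s | H.Adj x s} : Finset V)
    (fun z => #{D ∈ isolatedFree H | z ∉ D}) ⟨y₁, by simpa using hy₁⟩
  have hxy : H.Adj x y := by simpa using hy
  obtain ⟨k, hk⟩ := Nat.exists_eq_add_one.2 (card_pos.2 ⟨y, hy⟩)
  refine ⟨x, y, hxy, ?_⟩
  have hpend := card_exists_pendant_le hxy hk
    (fun v w hvw => hk ▸ hxmin v (by simpa using ⟨w, hvw⟩))
    (fun z hz => hymax z (by simpa using hz))
  have hnon : #{C ∈ isolatedFree H | (x ∈ C ∧ y ∈ C) ∧ ¬∃ z, IsPendant H x C z} ≤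
      #{C ∈ isolatedFree H | y ∈ C ∧ x ∉ C} := by
    refine card_le_card_of_injOn (fun C => C.erase x) (fun C hC => ?_) ?_
    · simp only [mem_coe, mem_filter, mem_isolatedFree, mem_erase] at hC ⊢
      obtain ⟨hC, ⟨-, hyC⟩, hno⟩ := hC
      refine ⟨?_, ⟨hxy.ne', hyC⟩, by simp⟩
      rintro v ⟨-, hv⟩
      by_contra! hcon
      have hall : ∀ w ∈ C, H.Adj v w → w = x := fun w hw hvw => by
        by_contra hwx
        exact hcon w ⟨hwx, hw⟩ hvw
      obtain ⟨w, hw, hvw⟩ := hC v hv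
      exact hno ⟨v, hv, (hall w hw hvw ▸ hvw).symm, hall⟩
    · intro C hC D hD h
      simp only [mem_coe, mem_filter] at hC hD
      rw [← insert_erase hC.2.1.1, ← insert_erase hD.2.1.1]
      exact congrArg (insert x) h
  have h1 := card_filter_add_card_filter_not (s := isolatedFree H) (fun C => y ∈ C)
  have h2 := card_filter_add_card_filter_not (s := {C ∈ isolatedFree H | y ∈ C}) (fun C => x ∈ C)
  have h3 := card_filter_add_card_filter_not (s := {C ∈ isolatedFree H | x ∈ C ∧ y ∈ C})
    (fun C => ∃ z, IsPendant H x C z)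
  simp only [filter_filter] at h2 h3
  have h4 : #{C ∈ isolatedFree H | y ∈ C ∧ x ∈ C} = #{C ∈ isolatedFree H | x ∈ C ∧ y ∈ C} := by
    simp only [and_comm]
  omega

end IsolatedFree

/-- The graph on the vertices of `G` joining two distinct common neighbours of a vertex of `U`. -/
def commonNeighborGraph {V : Type*} (G : SimpleGraph V) (U : Set V) : SimpleGraph V where
  Adj a b := a ≠ b ∧ ∃ u ∈ U, G.Adj u a ∧ G.Adj u b
  symm := ⟨fun _ _ ⟨hne, u, hu, ha, hb⟩ => ⟨hne.symm, u, hu, hb, ha⟩⟩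
  loopless := ⟨fun _ h => h.1 rfl⟩

section Bipartition

variable {V : Type*} {G : SimpleGraph V} {U W : Set V}

lemma IsBipartition.mem_right_of_adj (hb : IsBipartition G U W) {u w : V} (hu : u ∈ U)
    (huw : G.Adj u w) : w ∈ W := by
  rcases (hb.1 ▸ Set.mem_univ w : w ∈ U ∪ W) with h | h
  · exact absurd huw (hb.2.2.1 hu h)
  · exact h

lemma IsBipartition.mem_left_of_adj (hb : IsBipartition G U W) {u w : V} (hw : w ∈ W)
    (huw : G.Adj w u) : u ∈ U := by
  rcases (hb.1 ▸ Set.mem_univ u : u ∈ U ∪ W) with h | h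
  · exact h
  · exact absurd huw (hb.2.2.2 hw h)

lemma IsMaxStable.mem_iff {S : Set V} (hS : IsMaxStable G S) {v : V} :
    v ∈ S ↔ ∀ w, G.Adj v w → w ∉ S := by
  refine ⟨fun hv w hvw hw => hS.1 hv hw hvw, fun h => ?_⟩
  by_contra hv
  obtain ⟨w, hw, hvw⟩ := hS.2 v hv
  exact h w hvw hw

lemma IsBipartition.injOn_diff (hb : IsBipartition G U W) :
    Set.InjOn (fun S => W \ S) (MSS G) := by
  have hsub {S T : Set V} (hS : IsMaxStable G S) (hT : IsMaxStable G T) (h : W \ S = W \ T) :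
      S ⊆ T := by
    have hW (w : V) (hw : w ∈ W) : w ∈ S ↔ w ∈ T := by
      have := Set.ext_iff.1 h w
      simp only [Set.mem_sdiff, hw, true_and] at this
      tauto
    intro v hv
    rcases (hb.1 ▸ Set.mem_univ v : v ∈ U ∪ W) with hvU | hvW
    · refine hT.mem_iff.2 fun w hvw hw => ?_
      exact hS.mem_iff.1 hv w hvw ((hW w (hb.mem_right_of_adj hvU hvw)).2 hw)
    · exact (hW v hvW).1 hv
  intro S hS T hT h
  exact (hsub hS hT h).antisymm (hsub hT hS h.symm)

lemma IsBipartition.image_diff_MSS (hb : IsBipartition G U W)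
    (hdeg : ∀ u ∈ U, (G.neighborSet u).ncard = 2) :
    (fun S => W \ S) '' MSS G =
      {C | ∀ v ∈ C, ∃ w ∈ C, (commonNeighborGraph G U).Adj v w} := by
  ext C
  constructor
  · rintro ⟨S, hS, rfl⟩ v ⟨hvW, hvS⟩
    obtain ⟨u, huS, hvu⟩ := hS.2 v hvS
    have huU := hb.mem_left_of_adj hvW hvu
    obtain ⟨w, hw, hwv⟩ := Set.exists_ne_of_one_lt_ncard (by rw [hdeg u huU]; simp) v
    exact ⟨w, ⟨hb.mem_right_of_adj huU hw, hS.mem_iff.1 huS w hw⟩, hwv.symm, u, huU, hvu.symm, hw⟩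
  · intro hC
    have hCW : C ⊆ W := fun v hv => by
      obtain ⟨w, -, -, u, hu, huv, -⟩ := hC v hv
      exact hb.mem_right_of_adj hu huv
    have hdisj {v : V} (hU : v ∈ U) (hW : v ∈ W) : False := Set.disjoint_left.1 hb.2.1 hU hW
    refine ⟨{v | (v ∈ W ∧ v ∉ C) ∨ (v ∈ U ∧ ∀ w, G.Adj v w → w ∈ C)}, ⟨?_, ?_⟩, ?_⟩
    · rintro u (⟨hu, huC⟩ | ⟨hu, huC⟩) v (⟨hv, hvC⟩ | ⟨hv, hvC⟩) huv
      · exact hb.2.2.2 hu hv huv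
      · exact huC (hvC u huv.symm)
      · exact hvC (huC v huv)
      · exact hb.2.2.1 hu hv huv
    · intro v hv
      simp only [Set.mem_ofPred_eq, not_or, not_and, not_not, not_forall] at hv
      rcases (hb.1 ▸ Set.mem_univ v : v ∈ U ∪ W) with hvU | hvW
      · obtain ⟨w, hvw, hw⟩ := hv.2 hvU
        exact ⟨w, Or.inl ⟨hb.mem_right_of_adj hvU hvw, hw⟩, hvw⟩
      · obtain ⟨w, hwC, hvw, u, hu, huv, huw⟩ := hC v (hv.1 hvW)
        refine ⟨u, Or.inr ⟨hu, fun t hut => ?_⟩, huv.symm⟩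
        obtain ⟨p, q, -, hpq⟩ := Set.ncard_eq_two.1 (hdeg u hu)
        have hmem (s : V) (hs : G.Adj u s) : s = p ∨ s = q := by
          have : s ∈ G.neighborSet u := hs
          simpa [hpq] using this
        have hvC := hv.1 hvW
        rcases hmem t hut with rfl | rfl <;> rcases hmem v huv with rfl | rfl <;>
          rcases hmem w huw with rfl | rfl <;> first | assumption | exact absurd rfl hvw
    · ext v
      constructor
      · rintro ⟨hvW, hv⟩
        by_contra hvC
        exact hv (Or.inl ⟨hvW, hvC⟩)
      · refine fun hv => ⟨hCW hv, ?_⟩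
        rintro (⟨-, h⟩ | ⟨h, -⟩)
        · exact h hv
        · exact hdisj h (hCW hv)

end Bipartition

/-- In a finite twin-free bipartite graph in which `U` is nonempty and every vertex of `U`
has degree exactly `2`, the class `U` contains a rare vertex. -/
theorem degree_two_side_rare {V : Type} [Fintype V] (G : SimpleGraph V) (U W : Set V)
    (hb : IsBipartition G U W)
    (htf : ∀ v w : V, v ≠ w → G.neighborSet v ≠ G.neighborSet w)
    (hU : U.Nonempty) (hdeg : ∀ u ∈ U, (G.neighborSet u).ncard = 2) :
    ∃ u ∈ U, Rare G u := by
  classical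
  set H := commonNeighborGraph G U
  have hedge : ∃ x y, H.Adj x y := by
    obtain ⟨u, hu⟩ := hU
    obtain ⟨p, q, hne, hpq⟩ := Set.ncard_eq_two.1 (hdeg u hu)
    have hp : p ∈ G.neighborSet u := by simp [hpq]
    have hq : q ∈ G.neighborSet u := by simp [hpq]
    exact ⟨p, q, hne, u, hu, hp, hq⟩
  obtain ⟨x, y, ⟨hxy, u, hu, hux, huy⟩, hle⟩ := exists_adj_two_mul_card_le H hedge
  have hN : G.neighborSet u = {x, y} := by
    refine (Set.eq_of_subset_of_ncard_le ?_ ?_).symm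
    · rintro v (rfl | rfl)
      exacts [hux, huy]
    · rw [hdeg u hu, Set.ncard_pair hxy]
  have hcoe : Function.Injective ((↑) : Finset V → Set V) := Finset.coe_injective
  have himage := hb.image_diff_MSS hdeg
  have hall : (MSS G).ncard = (isolatedFree H).card := by
    rw [← hb.injOn_diff.ncard_image, himage, ← Set.ncard_coe_finset,
      ← Set.ncard_image_of_injective _ hcoe]
    congr 1
    ext C
    constructor
    · exact fun hC => ⟨C.toFinset, by simpa [mem_isolatedFree] using hC, by simp⟩
    · rintro ⟨D, hD, rfl⟩
      simpa [mem_isolatedFree] using hD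
  have hon : mssOn G {u} = ((isolatedFree H).filter fun C => x ∈ C ∧ y ∈ C).card := by
    have hinj : Set.InjOn (fun S => W \ S) {S | S ∈ MSS G ∧ {u} ⊆ S} :=
      hb.injOn_diff.mono fun S hS => hS.1
    rw [mssOn, ← hinj.ncard_image, ← Set.ncard_coe_finset, ← Set.ncard_image_of_injective _ hcoe]
    have hmem (S : Set V) (hS : S ∈ MSS G) : u ∈ S ↔ x ∈ W \ S ∧ y ∈ W \ S := by
      have hadj (w : V) : G.Adj u w ↔ w = x ∨ w = y := by
        rw [← SimpleGraph.mem_neighborSet, hN]; simp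
      rw [IsMaxStable.mem_iff hS]
      simp [hadj, hb.mem_right_of_adj hu hux, hb.mem_right_of_adj hu huy]
    congr 1
    ext C
    constructor
    · rintro ⟨S, ⟨hS, huS⟩, rfl⟩
      have hC : W \ S ∈ (fun S => W \ S) '' MSS G := ⟨S, hS, rfl⟩
      rw [himage] at hC
      have hxyS := (hmem S hS).1 (huS rfl)
      refine ⟨(W \ S).toFinset, ?_, by simp⟩
      simp only [Finset.coe_filter, Set.mem_ofPred_eq, mem_isolatedFree, Set.mem_toFinset]
      exact ⟨hC, hxyS⟩
    · rintro ⟨D, hD, rfl⟩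
      simp only [Finset.coe_filter, Set.mem_ofPred_eq, mem_isolatedFree] at hD
      have hC : (D : Set V) ∈ (fun S => W \ S) '' MSS G := by
        rw [himage]
        simpa using hD.1
      obtain ⟨S, hS, hSD⟩ := hC
      refine ⟨S, ⟨hS, ?_⟩, hSD⟩
      rw [Set.singleton_subset_iff, hmem S hS, show W \ S = (D : Set V) from hSD]
      simpa using hD.2
  refine ⟨u, hu, ?_⟩
  rw [Rare, hall, hon]
  exact hle
end
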